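/- Let L be a Cameron-Liebler line class of parameter x in AG(3,q). Then for every affine line ℓ, the number of lines of L disjoint from ℓ (in AG(3,q)) equals (q^2+1)(x - χ_L(ℓ)), and through every point at infinity there pass exactly x lines of L. -/

import Mathlib

open scoped Classical

namespace CL

variable (F : Type) [Field F] [Fintype F]

/-- Points of PG(3,q): 1-dimensional subspaces of F^4. -/
def PGPoint := {W : Submodule F (Fin 4 → F) // Module.finrank F W = 1}

/-- Lines of PG(3,q): 2-dimensional subspaces of F^4. -/
def PGLine := {W : Submodule F (Fin 4 → F) // Module.finrank F W = 2}

/-- Planes of PG(3,q): 3-dimensional subspaces of F^4. -/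
def PGPlane := {W : Submodule F (Fin 4 → F) // Module.finrank F W = 3}

/-- The plane at infinity: the hyperplane of vectors with last coordinate zero. -/
def infPlane : Submodule F (Fin 4 → F) := LinearMap.ker (LinearMap.proj (3 : Fin 4))

variable {F}

/-- A line of PG(3,q) is affine (a line of AG(3,q)) if it is not contained in π_∞. -/
def affLine (ℓ : PGLine F) : Prop := ¬ ℓ.1 ≤ infPlane F

/-- A point of PG(3,q) is affine if it does not lie in π_∞. -/
def affPoint (p : PGPoint F) : Prop := ¬ p.1 ≤ infPlane F

/-- A line spread of PG(3,q): every point lies on exactly one line of S. -/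
def IsPGSpread (S : Set (PGLine F)) : Prop :=
  ∀ p : PGPoint F, ∃! ℓ, ℓ ∈ S ∧ p.1 ≤ ℓ.1

/-- A line spread of AG(3,q): a set of affine lines such that every affine point
lies on exactly one line of S (i.e. pairwise disjoint affine lines partitioning AG(3,q)). -/
def IsAGSpread (S : Set (PGLine F)) : Prop :=
  (∀ ℓ ∈ S, affLine ℓ) ∧ ∀ p : PGPoint F, affPoint p → ∃! ℓ, ℓ ∈ S ∧ p.1 ≤ ℓ.1

/-- A Cameron-Liebler line class of parameter x in PG(3,q). -/
def IsCLPG (L : Set (PGLine F)) (x : ℕ) : Prop :=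
  ∀ S : Set (PGLine F), IsPGSpread S → (L ∩ S).ncard = x

/-- A Cameron-Liebler line class of parameter x in AG(3,q). -/
def IsCLAG (L : Set (PGLine F)) (x : ℕ) : Prop :=
  (∀ ℓ ∈ L, affLine ℓ) ∧
  ∀ S : Set (PGLine F), IsAGSpread S → (L ∩ S).ncard = x

end CL

namespace CL

open Module Finset

variable {F : Type} [Field F]

instance PGLine.finite [Finite F] : Finite (PGLine F) :=
  inferInstanceAs (Finite {W : Submodule F (Fin 4 → F) // finrank F W = 2})

theorem finrank_infPlane : finrank F (infPlane F) = 3 := by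
  have h := LinearMap.finrank_range_add_finrank_ker
    (LinearMap.proj (R := F) (φ := fun _ : Fin 4 => F) 3)
  have hs : LinearMap.range (LinearMap.proj (R := F) (φ := fun _ : Fin 4 => F) 3) = ⊤ :=
    LinearMap.range_eq_top.mpr (LinearMap.proj_surjective 3)
  rw [hs, finrank_top, finrank_self, finrank_fin_fun] at h
  unfold infPlane
  omega

theorem finrank_inf_infPlane {T : Submodule F (Fin 4 → F)} (hT : ¬ T ≤ infPlane F) :
    finrank F ↥(T ⊓ infPlane F) + 1 = finrank F T := by
  have h := Submodule.finrank_sup_add_finrank_inf_eq T (infPlane F)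
  have hlt : infPlane F < T ⊔ infPlane F :=
    lt_of_le_of_ne le_sup_right fun e => hT (e ▸ le_sup_left)
  have h1 := Submodule.finrank_lt_finrank_of_lt hlt
  have h2 := Submodule.finrank_le (T ⊔ infPlane F)
  rw [finrank_fin_fun] at h2
  rw [finrank_infPlane] at h h1
  omega

theorem card_filter_mem [Fintype F] (T : Submodule F (Fin 4 → F)) :
    #{d : Fin 4 → F | d ∈ T} = Fintype.card F ^ finrank F T := by
  rw [← Fintype.card_subtype]
  exact Module.card_eq_pow_finrank

theorem card_filter_mem_not_mem [Fintype F] {T U : Submodule F (Fin 4 → F)} (h : U ≤ T) :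
    #{d : Fin 4 → F | d ∈ T ∧ d ∉ U} + Fintype.card F ^ finrank F U
      = Fintype.card F ^ finrank F T := by
  rw [← card_filter_mem, ← card_filter_mem, filter_and_not, card_sdiff_add_card_eq_card]
  intro d
  simpa using @h d

theorem finrank_span_pair {d v : Fin 4 → F} (hd : d ∈ infPlane F) (hd0 : d ≠ 0)
    (hv : v ∉ infPlane F) : finrank F (Submodule.span F {d, v}) = 2 := by
  have hn : ¬ Submodule.span F {d, v} ≤ infPlane F :=
    fun h => hv (h (Submodule.subset_span (by simp)))
  have h1 := finrank_inf_infPlane hn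
  have h2 : finrank F (Submodule.span F {d}) ≤
      finrank F ↥(Submodule.span F {d, v} ⊓ infPlane F) := by
    apply Submodule.finrank_mono
    rw [Submodule.span_singleton_le_iff_mem]
    exact ⟨Submodule.subset_span (by simp), hd⟩
  rw [finrank_span_singleton hd0] at h2
  have h3 : finrank F (Submodule.span F {d, v}) ≤ 2 := by
    have := finrank_span_le_card (R := F) ({d, v} : Set (Fin 4 → F))
    refine this.trans ?_
    rw [Set.toFinset_card, ← Nat.card_eq_fintype_card]
    exact Set.ncard_insert_le d {v} |>.trans (by simp)
  omega

/-- The affine line through the point at infinity `⟨d⟩` and the affine point `⟨v⟩`. -/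
def lineThrough {d v : Fin 4 → F} (hd : d ∈ infPlane F) (hd0 : d ≠ 0)
    (hv : v ∉ infPlane F) : PGLine F :=
  ⟨Submodule.span F {d, v}, finrank_span_pair hd hd0 hv⟩

theorem PGLine.eq_span {m : PGLine F} {d v : Fin 4 → F} (hd : d ∈ infPlane F) (hd0 : d ≠ 0)
    (hv : v ∉ infPlane F) (hdm : d ∈ m.1) (hvm : v ∈ m.1) :
    m.1 = Submodule.span F {d, v} := by
  refine (Submodule.eq_of_le_of_finrank_eq ?_ ?_).symm
  · rw [Submodule.span_le]
    rintro y (rfl | rfl) <;> assumption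
  · rw [finrank_span_pair hd hd0 hv, m.2]

theorem PGLine.le_of_mem {m : PGLine F} {d v : Fin 4 → F} (hd : d ∈ infPlane F) (hd0 : d ≠ 0)
    (hv : v ∉ infPlane F) (hdm : d ∈ m.1) (hvm : v ∈ m.1) {T : Submodule F (Fin 4 → F)}
    (hdT : d ∈ T) (hvT : v ∈ T) : m.1 ≤ T := by
  rw [PGLine.eq_span hd hd0 hv hdm hvm, Submodule.span_le]
  rintro y (rfl | rfl) <;> assumption

theorem PGLine.eq_of_mem {m n : PGLine F} {d v : Fin 4 → F} (hd : d ∈ infPlane F)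
    (hd0 : d ≠ 0) (hv : v ∉ infPlane F) (hdm : d ∈ m.1) (hvm : v ∈ m.1)
    (hdn : d ∈ n.1) (hvn : v ∈ n.1) : m = n :=
  Subtype.ext ((PGLine.eq_span hd hd0 hv hdm hvm).trans
    (PGLine.eq_span hd hd0 hv hdn hvn).symm)

theorem affLine.exists_mem {m : PGLine F} (hm : affLine m) : ∃ v ∈ m.1, v ∉ infPlane F :=
  SetLike.not_le_iff_exists.mp hm

theorem affLine.finrank_inf {m : PGLine F} (hm : affLine m) :
    finrank F ↥(m.1 ⊓ infPlane F) = 1 := by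
  have := finrank_inf_infPlane hm
  rw [m.2] at this
  omega

theorem affLine.inf_eq_span {m : PGLine F} (hm : affLine m) {d : Fin 4 → F}
    (hd : d ∈ infPlane F) (hd0 : d ≠ 0) (hdm : d ∈ m.1) :
    m.1 ⊓ infPlane F = Submodule.span F {d} := by
  refine (Submodule.eq_of_le_of_finrank_eq ?_ ?_).symm
  · rw [Submodule.span_singleton_le_iff_mem]
    exact ⟨hdm, hd⟩
  · rw [finrank_span_singleton hd0, hm.finrank_inf]

theorem affLine.exists_mem_infPlane {m : PGLine F} (hm : affLine m) :
    ∃ d ∈ m.1, d ∈ infPlane F ∧ d ≠ 0 := by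
  obtain ⟨d, hd, -⟩ := finrank_eq_one_iff'.mp hm.finrank_inf
  exact ⟨d.1, d.2.1, d.2.2, fun h => hd (Subtype.ext h)⟩

theorem PGPoint.exists_eq_span (p : PGPoint F) : ∃ v, v ≠ 0 ∧ p.1 = Submodule.span F {v} := by
  obtain ⟨v, hv, h⟩ := finrank_eq_one_iff'.mp p.2
  have hv0 : v.1 ≠ 0 := fun h => hv (Subtype.ext h)
  refine ⟨v.1, hv0, (Submodule.eq_of_le_of_finrank_eq ?_ ?_).symm⟩
  · rw [Submodule.span_singleton_le_iff_mem]
    exact v.2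
  · rw [finrank_span_singleton hv0, p.2]

/-- Two lines meet in an affine point, expressed with vectors. -/
def Meets (m n : PGLine F) : Prop := ∃ v, v ∉ infPlane F ∧ v ∈ m.1 ∧ v ∈ n.1

theorem exists_affPoint_le_iff {m n : PGLine F} :
    (∃ p : PGPoint F, affPoint p ∧ p.1 ≤ m.1 ∧ p.1 ≤ n.1) ↔ Meets m n := by
  constructor
  · rintro ⟨p, hp, hm, hn⟩
    obtain ⟨v, hvp, hv⟩ := SetLike.not_le_iff_exists.mp hp
    exact ⟨v, hv, hm hvp, hn hvp⟩
  · rintro ⟨v, hv, hm, hn⟩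
    have hv0 : v ≠ 0 := by
      rintro rfl
      exact hv (zero_mem _)
    refine ⟨⟨Submodule.span F {v}, finrank_span_singleton hv0⟩, ?_, ?_, ?_⟩
    · exact fun h => hv ((Submodule.span_singleton_le_iff_mem _ _).mp h)
    · rwa [Submodule.span_singleton_le_iff_mem]
    · rwa [Submodule.span_singleton_le_iff_mem]

/-- Inside a subspace `T` take the parallel class of `w`, outside `T` the parallel class of `d`. -/
theorem isAGSpread_switch {T : Submodule F (Fin 4 → F)} {w d : Fin 4 → F}
    (hw : w ∈ infPlane F) (hw0 : w ≠ 0) (hwT : w ∈ T)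
    (hd : d ∈ infPlane F) (hd0 : d ≠ 0) (hdT : d ∈ T) :
    IsAGSpread {m : PGLine F | affLine m ∧ (w ∈ m.1 ∧ m.1 ≤ T ∨ d ∈ m.1 ∧ ¬ m.1 ≤ T)} := by
  refine ⟨fun m hm => hm.1, fun p hp => ?_⟩
  obtain ⟨v, -, hpv⟩ := p.exists_eq_span
  rw [affPoint, hpv, Submodule.span_singleton_le_iff_mem] at hp
  simp only [hpv, Submodule.span_singleton_le_iff_mem, Set.mem_ofPred_eq]
  have hmem : ∀ {e : Fin 4 → F} (he : e ∈ infPlane F) (he0 : e ≠ 0),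
      e ∈ (lineThrough he he0 hp).1 ∧ v ∈ (lineThrough he he0 hp).1 := fun he he0 =>
    ⟨Submodule.subset_span (by simp), Submodule.subset_span (by simp)⟩
  by_cases hvT : v ∈ T
  · obtain ⟨h1, h2⟩ := hmem hw hw0
    refine ⟨lineThrough hw hw0 hp, ⟨⟨fun h => hp (h h2), Or.inl ⟨h1, ?_⟩⟩, h2⟩, ?_⟩
    · exact PGLine.le_of_mem hw hw0 hp h1 h2 hwT hvT
    · rintro n ⟨⟨-, ⟨hn, -⟩ | ⟨hn, hnT⟩⟩, hvn⟩
      · exact PGLine.eq_of_mem hw hw0 hp hn hvn h1 h2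
      · exact absurd (PGLine.le_of_mem hd hd0 hp hn hvn hdT hvT) hnT
  · obtain ⟨h1, h2⟩ := hmem hd hd0
    refine ⟨lineThrough hd hd0 hp,
      ⟨⟨fun h => hp (h h2), Or.inr ⟨h1, fun h => hvT (h h2)⟩⟩, h2⟩, ?_⟩
    rintro n ⟨⟨-, ⟨-, hnT⟩ | ⟨hn, -⟩⟩, hvn⟩
    · exact absurd (hnT hvn) hvT
    · exact PGLine.eq_of_mem hd hd0 hp hn hvn h1 h2

theorem affLine.meets_iff_eq {ℓ m : PGLine F} (hℓ : affLine ℓ) {w : Fin 4 → F}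
    (hw : w ∈ infPlane F) (hw0 : w ≠ 0) (hwℓ : w ∈ ℓ.1) (hwm : w ∈ m.1) :
    Meets m ℓ ↔ m = ℓ := by
  constructor
  · rintro ⟨v, hv, hvm, hvℓ⟩
    exact PGLine.eq_of_mem hw hw0 hv hwm hvm hwℓ hvℓ
  · rintro rfl
    obtain ⟨v, hvm, hv⟩ := hℓ.exists_mem
    exact ⟨v, hv, hvm, hvm⟩

theorem finrank_sup_span_singleton_le (ℓ : PGLine F) (d : Fin 4 → F) :
    finrank F ↥(ℓ.1 ⊔ Submodule.span F {d}) ≤ 3 := by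
  have h1 := Submodule.finrank_add_le_finrank_add_finrank ℓ.1 (Submodule.span F {d})
  have h2 := finrank_span_le_card (R := F) ({d} : Set (Fin 4 → F))
  have h3 := ℓ.2
  simp only [Set.toFinset_singleton, card_singleton] at h2
  omega

theorem affLine.meets_iff_le {ℓ m : PGLine F} (hm : affLine m)
    {d : Fin 4 → F} (hd : d ∈ infPlane F) (hdℓ : d ∉ ℓ.1) (hdm : d ∈ m.1) :
    Meets m ℓ ↔ m.1 ≤ ℓ.1 ⊔ Submodule.span F {d} := by
  have hd0 : d ≠ 0 := by
    rintro rfl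
    exact hdℓ (zero_mem _)
  constructor
  · rintro ⟨v, hv, hvm, hvℓ⟩
    exact PGLine.le_of_mem hd hd0 hv hdm hvm
      (Submodule.mem_sup_right (Submodule.mem_span_singleton_self d))
      (Submodule.mem_sup_left hvℓ)
  · intro h
    have h1 := Submodule.finrank_sup_add_finrank_inf_eq m.1 ℓ.1
    have h2 := (Submodule.finrank_mono (sup_le h le_sup_left)).trans
      (finrank_sup_span_singleton_le ℓ d)
    have hne : m.1 ⊓ ℓ.1 ≠ ⊥ := by
      intro e
      rw [e, finrank_bot, m.2, ℓ.2] at h1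
      omega
    obtain ⟨v, ⟨hvm, hvℓ⟩, hv0⟩ := Submodule.exists_mem_ne_zero_of_ne_bot hne
    refine ⟨v, fun hv => hdℓ ?_, hvm, hvℓ⟩
    have hdv : d ∈ Submodule.span F {v} := by
      rw [← hm.inf_eq_span hv hv0 hvm]
      exact ⟨hdm, hd⟩
    exact (Submodule.span_singleton_le_iff_mem _ _).mpr hvℓ hdv

theorem finrank_sup_of_ne {ℓ m : PGLine F} (hne : m ≠ ℓ) {w : Fin 4 → F} (hw0 : w ≠ 0)
    (hwℓ : w ∈ ℓ.1) (hwm : w ∈ m.1) : finrank F ↥(ℓ.1 ⊔ m.1) = 3 := by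
  have h1 := Submodule.finrank_sup_add_finrank_inf_eq ℓ.1 m.1
  have h2 : 1 ≤ finrank F ↥(ℓ.1 ⊓ m.1) := by
    rw [← finrank_span_singleton (K := F) hw0]
    apply Submodule.finrank_mono
    rw [Submodule.span_singleton_le_iff_mem]
    exact ⟨hwℓ, hwm⟩
  have h3 : ℓ.1 < ℓ.1 ⊔ m.1 := by
    refine lt_of_le_of_ne le_sup_left fun e => hne (Subtype.ext ?_)
    exact Submodule.eq_of_le_of_finrank_eq (e ▸ le_sup_right) (m.2.trans ℓ.2.symm)
  have h4 := Submodule.finrank_lt_finrank_of_lt h3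
  rw [ℓ.2] at h1 h4
  rw [m.2] at h1
  omega

theorem le_sup_span_singleton_iff {ℓ m : PGLine F} (hne : m ≠ ℓ) {w : Fin 4 → F}
    (hw0 : w ≠ 0) (hwℓ : w ∈ ℓ.1) (hwm : w ∈ m.1) {d : Fin 4 → F} (hdℓ : d ∉ ℓ.1) :
    m.1 ≤ ℓ.1 ⊔ Submodule.span F {d} ↔ d ∈ ℓ.1 ⊔ m.1 := by
  have h3 := finrank_sup_of_ne hne hw0 hwℓ hwm
  have hdT : d ∈ ℓ.1 ⊔ Submodule.span F {d} :=
    Submodule.mem_sup_right (Submodule.mem_span_singleton_self d)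
  constructor
  · intro h
    rwa [Submodule.eq_of_le_of_finrank_le (sup_le le_sup_left h)
      (h3 ▸ finrank_sup_span_singleton_le ℓ d)]
  · intro h
    have hlt : ℓ.1 < ℓ.1 ⊔ Submodule.span F {d} :=
      lt_of_le_of_ne le_sup_left fun e => hdℓ (by rw [e]; exact hdT)
    have h4 := Submodule.finrank_lt_finrank_of_lt hlt
    rw [ℓ.2] at h4
    have hle : ℓ.1 ⊔ Submodule.span F {d} ≤ ℓ.1 ⊔ m.1 :=
      sup_le le_sup_left ((Submodule.span_singleton_le_iff_mem _ _).mpr h)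
    rw [Submodule.eq_of_le_of_finrank_le hle (by omega)]
    exact le_sup_right

theorem card_directions_le_sup [Fintype F] {ℓ m : PGLine F} (hℓ : affLine ℓ) (hne : m ≠ ℓ)
    {w : Fin 4 → F} (hw0 : w ≠ 0) (hwℓ : w ∈ ℓ.1) (hwm : w ∈ m.1) :
    #{d : Fin 4 → F | (d ∈ infPlane F ∧ d ∉ ℓ.1) ∧ m.1 ≤ ℓ.1 ⊔ Submodule.span F {d}}
      + Fintype.card F = Fintype.card F ^ 2 := by
  have hT : ¬ ℓ.1 ⊔ m.1 ≤ infPlane F := fun h => hℓ (le_sup_left.trans h)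
  have h1 := finrank_inf_infPlane hT
  rw [finrank_sup_of_ne hne hw0 hwℓ hwm] at h1
  have h2 := card_filter_mem_not_mem (F := F) (T := (ℓ.1 ⊔ m.1) ⊓ infPlane F)
    (U := ℓ.1 ⊓ infPlane F) (inf_le_inf_right _ le_sup_left)
  rw [hℓ.finrank_inf, show finrank F ↥((ℓ.1 ⊔ m.1) ⊓ infPlane F) = 2 by omega, pow_one] at h2
  rw [← h2]
  congr 2
  ext d
  simp only [mem_filter, mem_univ, true_and, Submodule.mem_inf]
  constructor
  · rintro ⟨⟨hd, hdℓ⟩, h⟩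
    exact ⟨⟨(le_sup_span_singleton_iff hne hw0 hwℓ hwm hdℓ).mp h, hd⟩, fun h => hdℓ h.1⟩
  · rintro ⟨⟨h, hd⟩, hn⟩
    have hdℓ : d ∉ ℓ.1 := fun h' => hn ⟨h', hd⟩
    exact ⟨⟨hd, hdℓ⟩, (le_sup_span_singleton_iff hne hw0 hwℓ hwm hdℓ).mpr h⟩

theorem IsCLAG.ncard_mem {L : Set (PGLine F)} {x : ℕ} (h : IsCLAG L x) {w : Fin 4 → F}
    (hw : w ∈ infPlane F) (hw0 : w ≠ 0) : {m ∈ L | w ∈ m.1}.ncard = x := by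
  rw [← h.2 _ (isAGSpread_switch (T := ⊤) hw hw0 trivial hw hw0 trivial)]
  congr 1
  ext m
  have := h.1 m
  simp only [Set.mem_ofPred_eq, Set.mem_inter_iff, le_top]
  tauto

/-- The members of `L` through `d` missing `ℓ`, together with those through `w` in the plane `⟨ℓ, d⟩`,
number `x`. -/
theorem IsCLAG.ncard_mem_disjoint_add [Finite F] {L : Set (PGLine F)} {x : ℕ} (h : IsCLAG L x)
    {ℓ : PGLine F} {w d : Fin 4 → F}
    (hw : w ∈ infPlane F) (hw0 : w ≠ 0) (hwℓ : w ∈ ℓ.1) (hd : d ∈ infPlane F)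
    (hdℓ : d ∉ ℓ.1) :
    {m ∈ L | (¬ Meets m ℓ) ∧ d ∈ m.1}.ncard
      + {m ∈ L | w ∈ m.1 ∧ m.1 ≤ ℓ.1 ⊔ Submodule.span F {d}}.ncard = x := by
  have hd0 : d ≠ 0 := by
    rintro rfl
    exact hdℓ (zero_mem _)
  rw [← h.2 _ (isAGSpread_switch (T := ℓ.1 ⊔ Submodule.span F {d}) hw hw0
    (Submodule.mem_sup_left hwℓ) hd hd0
    (Submodule.mem_sup_right (Submodule.mem_span_singleton_self d))),
    ← Set.ncard_union_eq]
  · congr 1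
    ext m
    have h1 := h.1 m
    have h2 := fun hm hdm => affLine.meets_iff_le (m := m) (ℓ := ℓ) hm hd hdℓ hdm
    simp only [Set.mem_ofPred_eq, Set.mem_inter_iff, Set.mem_union]
    tauto
  · rw [Set.disjoint_left]
    rintro m ⟨hm, hn, hdm⟩ ⟨-, -, hle⟩
    exact hn ((affLine.meets_iff_le (h.1 m hm) hd hdℓ hdm).mpr hle)

theorem IsCLAG.ncard_parallel_add [Finite F] {L : Set (PGLine F)} {x : ℕ} (h : IsCLAG L x)
    {ℓ : PGLine F} {w : Fin 4 → F} (hw : w ∈ infPlane F) (hw0 : w ≠ 0) (hwℓ : w ∈ ℓ.1) :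
    {m ∈ L | w ∈ m.1 ∧ m ≠ ℓ}.ncard + (if ℓ ∈ L then 1 else 0) = x := by
  rw [← h.ncard_mem hw hw0]
  split_ifs with hL
  · rw [← Set.ncard_sdiff_singleton_add_one (a := ℓ) (s := {m ∈ L | w ∈ m.1}) ⟨hL, hwℓ⟩]
    congr 2
    ext m
    simp only [Set.mem_ofPred_eq, Set.mem_sdiff, Set.mem_singleton_iff]
    tauto
  · rw [add_zero]
    congr 1
    ext m
    simp only [Set.mem_ofPred_eq]
    constructor
    · tauto
    · rintro ⟨hm, hwm⟩
      exact ⟨hm, hwm, fun e => hL (e ▸ hm)⟩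

theorem IsCLAG.ncard_disjoint [Fintype F] {L : Set (PGLine F)} {x : ℕ} (h : IsCLAG L x)
    {ℓ : PGLine F} (hℓ : affLine ℓ) :
    {m ∈ L | ¬ Meets m ℓ}.ncard
      = (Fintype.card F ^ 2 + 1) * (x - (if ℓ ∈ L then 1 else 0)) := by
  obtain ⟨w, hwℓ, hw, hw0⟩ := hℓ.exists_mem_infPlane
  have : Fintype (PGLine F) := Fintype.ofFinite _
  have toCard : ∀ (P : PGLine F → Prop) [DecidablePred fun m => m ∈ L ∧ P m],
      {m ∈ L | P m}.ncard = #{m : PGLine F | m ∈ L ∧ P m} := by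
    intro P _
    rw [← Set.ncard_coe_finset]
    simp
  have hpar := h.ncard_parallel_add (ℓ := ℓ) hw hw0 hwℓ
  set q := Fintype.card F with hq
  set χ := if ℓ ∈ L then 1 else 0 with hχ
  set y := {m ∈ L | w ∈ m.1 ∧ m ≠ ℓ}.ncard with hy
  let A : Finset (Fin 4 → F) := {d | d ∈ infPlane F ∧ d ∉ ℓ.1}
  let B : Finset (Fin 4 → F) := {d | d ∈ ℓ.1 ⊓ infPlane F ∧ d ∉ (⊥ : Submodule F (Fin 4 → F))}
  have hq1 : 1 < q := Fintype.one_lt_card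
  have hA : #A + q = q ^ 3 := by
    have := card_filter_mem_not_mem (F := F) (T := infPlane F) (U := ℓ.1 ⊓ infPlane F)
      inf_le_right
    rw [hℓ.finrank_inf, finrank_infPlane, pow_one] at this
    rw [← this]
    congr 2
    ext d
    simp only [A, mem_filter, mem_univ, true_and, Submodule.mem_inf]
    tauto
  have hB : #B + 1 = q := by
    have := card_filter_mem_not_mem (F := F) (T := ℓ.1 ⊓ infPlane F) (U := ⊥) bot_le
    rwa [hℓ.finrank_inf, finrank_bot, pow_zero, pow_one] at this
  have hAB : Disjoint A B := by
    rw [Finset.disjoint_left]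
    intro d
    simp only [A, B, mem_filter, mem_univ, true_and, Submodule.mem_inf]
    tauto
  have hsum : ∑ d ∈ A ∪ B, #{m : PGLine F | m ∈ L ∧ ¬ Meets m ℓ ∧ d ∈ m.1}
      = #{m : PGLine F | m ∈ L ∧ ¬ Meets m ℓ} * (q - 1) := by
    have key := sum_card_bipartiteAbove_eq_sum_card_bipartiteBelow
      (s := A ∪ B) (t := {m : PGLine F | m ∈ L ∧ ¬ Meets m ℓ}) (fun d m => d ∈ m.1)
    simp only [bipartiteAbove, bipartiteBelow, filter_filter, and_assoc] at key
    rw [key, ← smul_eq_mul, ← sum_const]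
    refine sum_congr rfl fun m hm => ?_
    have hm' := h.1 m (mem_filter.mp hm).2.1
    have := card_filter_mem_not_mem (F := F) (T := m.1 ⊓ infPlane F) (U := ⊥) bot_le
    rw [hm'.finrank_inf, finrank_bot, pow_zero, pow_one] at this
    rw [hq, ← this, Nat.add_sub_cancel]
    congr 1
    ext d
    have h0 : d = 0 → d ∈ ℓ.1 := by
      rintro rfl
      exact zero_mem _
    simp only [A, B, mem_filter, mem_union, mem_univ, true_and, Submodule.mem_inf,
      Submodule.mem_bot]
    tauto
  have hsumB : ∑ d ∈ B, #{m : PGLine F | m ∈ L ∧ ¬ Meets m ℓ ∧ d ∈ m.1} = #B * y := by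
    rw [← smul_eq_mul, ← sum_const]
    refine sum_congr rfl fun d hd => ?_
    simp only [B, mem_filter, mem_univ, true_and, Submodule.mem_inf, Submodule.mem_bot] at hd
    obtain ⟨⟨hdℓ, hd⟩, hd0⟩ := hd
    have h1 := h.ncard_parallel_add (ℓ := ℓ) hd hd0 hdℓ
    have h2 : {m ∈ L | d ∈ m.1 ∧ m ≠ ℓ}.ncard = y := by omega
    rw [← h2, toCard]
    congr 1
    ext m
    have h3 := fun hdm => hℓ.meets_iff_eq (m := m) hd hd0 hdℓ hdm
    simp only [mem_filter, mem_univ, true_and]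
    tauto
  have hsumA : ∑ d ∈ A, #{m : PGLine F | m ∈ L ∧ ¬ Meets m ℓ ∧ d ∈ m.1}
      + ∑ d ∈ A, #{m : PGLine F | m ∈ L ∧ w ∈ m.1 ∧ m.1 ≤ ℓ.1 ⊔ Submodule.span F {d}}
      = #A * x := by
    rw [← sum_add_distrib, ← smul_eq_mul, ← sum_const]
    refine sum_congr rfl fun d hd => ?_
    simp only [A, mem_filter, mem_univ, true_and] at hd
    rw [← h.ncard_mem_disjoint_add hw hw0 hwℓ hd.1 hd.2, toCard, toCard]
  have hsumP : ∑ d ∈ A,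
      #{m : PGLine F | m ∈ L ∧ w ∈ m.1 ∧ m.1 ≤ ℓ.1 ⊔ Submodule.span F {d}}
      = χ * #A + y * (q ^ 2 - q) := by
    have key := sum_card_bipartiteAbove_eq_sum_card_bipartiteBelow
      (s := A) (t := {m : PGLine F | m ∈ L ∧ w ∈ m.1})
      (fun d m => m.1 ≤ ℓ.1 ⊔ Submodule.span F {d})
    simp only [bipartiteAbove, bipartiteBelow, filter_filter, and_assoc] at key
    rw [key, ← sum_filter_add_sum_filter_not _ (fun m => m = ℓ)]
    congr 1
    · rw [filter_filter, ← smul_eq_mul, hχ]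
      have hval : ∀ m ∈ ({m | (m ∈ L ∧ w ∈ m.1) ∧ m = ℓ} : Finset (PGLine F)),
          #{d ∈ A | m.1 ≤ ℓ.1 ⊔ Submodule.span F {d}} = #A := by
        intro m hm
        obtain rfl := (mem_filter.mp hm).2.2
        simp
      rw [sum_congr rfl hval, sum_const]
      congr 1
      split_ifs with hL
      · rw [card_eq_one]
        refine ⟨ℓ, ?_⟩
        ext m
        simp only [mem_filter, mem_univ, true_and, mem_singleton]
        constructor
        · tauto
        · rintro rfl
          exact ⟨⟨hL, hwℓ⟩, rfl⟩
      · rw [card_eq_zero, filter_eq_empty_iff]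
        rintro m - ⟨⟨hm, -⟩, rfl⟩
        exact hL hm
    · rw [filter_filter, hy, toCard, ← smul_eq_mul, ← sum_const]
      simp only [and_assoc]
      refine sum_congr (by ext; simp) fun m hm => ?_
      obtain ⟨-, -, hwm, hne⟩ := mem_filter.mp hm
      have := card_directions_le_sup hℓ hne hw0 hwℓ hwm
      rw [hq, ← this, Nat.add_sub_cancel]
      congr 1
      ext d
      simp only [A, mem_filter, mem_univ, true_and]
  rw [sum_union hAB, hsumB] at hsum
  rw [toCard]
  rw [show x - χ = y by omega]
  have hqq : q ≤ q ^ 2 := Nat.le_self_pow two_ne_zero q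
  rw [hsumP] at hsumA
  generalize #{m : PGLine F | m ∈ L ∧ ¬ Meets m ℓ} = N at *
  generalize ∑ d ∈ A, #{m : PGLine F | m ∈ L ∧ ¬ Meets m ℓ ∧ d ∈ m.1} = s at *
  have hq0 : ((q : ℤ) - 1) ≠ 0 := by omega
  zify [hqq, hq1.le] at *
  apply mul_right_cancel₀ hq0
  rw [← hsum, ← hpar] at *
  have hA' : (#A : ℤ) = q ^ 3 - q := by linarith
  have hB' : (#B : ℤ) = q - 1 := by linarith
  rw [hA'] at hsumA
  rw [hB']
  linear_combination hsumA

end CL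

/-- For a Cameron-Liebler line class L of parameter x in AG(3,q): for every affine line ℓ,
the number of lines of L disjoint from ℓ in AG(3,q) equals (q^2+1)(x - χ_L(ℓ)), and through
every point at infinity there pass exactly x lines of L. -/
theorem CLAG_disjoint_count (F : Type) [Field F] [Fintype F]
    (L : Set (CL.PGLine F)) (x : ℕ) (h : CL.IsCLAG L x) :
    (∀ ℓ : CL.PGLine F, CL.affLine ℓ →
      {m ∈ L | ¬ ∃ p : CL.PGPoint F, CL.affPoint p ∧ p.1 ≤ m.1 ∧ p.1 ≤ ℓ.1}.ncard
        = ((Fintype.card F) ^ 2 + 1) * (x - (if ℓ ∈ L then 1 else 0))) ∧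
    (∀ p : CL.PGPoint F, p.1 ≤ CL.infPlane F → {m ∈ L | p.1 ≤ m.1}.ncard = x) := by
  refine ⟨fun ℓ hℓ => ?_, fun p hp => ?_⟩
  · simp only [CL.exists_affPoint_le_iff]
    exact h.ncard_disjoint hℓ
  · obtain ⟨w, hw0, hpw⟩ := p.exists_eq_span
    rw [hpw, Submodule.span_singleton_le_iff_mem] at hp
    simp only [hpw, Submodule.span_singleton_le_iff_mem]
    exact h.ncard_mem hp hw0
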